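/- (Existence of an optimal control for the Bolza problem) Assume the control system satisfies (A1) and (A2), the running cost L satisfies (L1) superlinearity in u, (L2) local Lipschitz continuity in x, and (L3) for each fixed x and t the set { (v,l) ∈ ℝⁿ × ℝ : there exists u ∈ U with v = f(x,u) and l ≥ L(x,u,t) } is convex, and the initial cost I is continuous. Then for every (t,x) ∈ (0,T] × ℝⁿ the infimum defining V(t,x) is attained: there exists an admissible control–trajectory pair (u*,x*) on [0,t] with x*(t) = x such that V(t,x) = ∫₀ᵗ L(x*(s),u*(s),s) ds + I(x*(0)). -/

import Mathlib

open MeasureTheory Set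

noncomputable section

/-- Euclidean state space `ℝⁿ`. -/
abbrev En (n : ℕ) := EuclideanSpace ℝ (Fin n)

/-- An admissible control–trajectory pair on `[a,b]`: a measurable control `u`
taking values in the control set `U` on `[a,b]`, together with an absolutely
continuous solution `γ` of `γ' = f (γ s) (u s)`, written in integral form. -/
def IsAdmissible {n m : ℕ} (f : En n → En m → En n) (U : Set (En m)) (a b : ℝ)
    (u : ℝ → En m) (γ : ℝ → En n) : Prop :=
  Measurable u ∧ (∀ s ∈ Icc a b, u s ∈ U) ∧ ContinuousOn γ (Icc a b) ∧
    ∀ s ∈ Icc a b, γ s = γ a + ∫ r in a..s, f (γ r) (u r)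

/-- The value function of the Bolza problem with running cost `L` and
initial cost `I`. -/
def valueFun {n m : ℕ} (f : En n → En m → En n) (U : Set (En m))
    (L : En n → En m → ℝ → ℝ) (I : En n → ℝ) (t : ℝ) (x : En n) : ℝ :=
  sInf { J | ∃ u γ, IsAdmissible f U 0 t u γ ∧ γ t = x ∧
      J = (∫ s in (0:ℝ)..t, L (γ s) (u s) s) + I (γ 0) }


open Filter Topology

/-! ### Measurable selection -/

/-- If `g s` is continuous and nonnegative on a compact set `U` and vanishes somewhere on it, then
the minimum of `φ` over the zeros of `g s` in `U` depends measurably on `s`. -/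
theorem exists_measurable_value_on_zeros {α X : Type*} [MeasurableSpace α] [MetricSpace X]
    {U : Set X} (hU : IsCompact U) {g : α → X → ℝ} (hgm : ∀ u ∈ U, Measurable fun s => g s u)
    (hgc : ∀ s, ContinuousOn (g s) U) (hg0 : ∀ s, ∀ u ∈ U, 0 ≤ g s u)
    (hex : ∀ s, ∃ u ∈ U, g s u = 0) {φ : X → ℝ} (hφ : Continuous φ) :
    ∃ w : α → ℝ, Measurable w ∧ ∀ s, ∃ u ∈ U, g s u = 0 ∧ φ u = w s := by
  have hmin : ∀ s, ∃ u ∈ U, g s u = 0 ∧ ∀ v ∈ U, g s v = 0 → φ u ≤ φ v := by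
    intro s
    have hc : IsCompact (U ∩ g s ⁻¹' {0}) := by
      refine hU.of_isClosed_subset
        ((hgc s).preimage_isClosed_of_isClosed hU.isClosed isClosed_singleton) inter_subset_left
    obtain ⟨u₀, hu₀, hu₀'⟩ := hex s
    obtain ⟨u, hu, humin⟩ := hc.exists_isMinOn ⟨u₀, hu₀, hu₀'⟩ hφ.continuousOn
    exact ⟨u, hu.1, hu.2, fun v hv hv' => humin ⟨hv, hv'⟩⟩
  choose w hwU hw0 hwmin using hmin
  refine ⟨fun s => φ (w s), measurable_of_Iic fun c => ?_, fun s => ⟨w s, hwU s, hw0 s, rfl⟩⟩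
  set K := U ∩ {u | φ u ≤ c} with hK
  have hKc : IsCompact K := hU.inter_right (isClosed_le hφ continuous_const)
  obtain ⟨D, hDK, hDc, hD⟩ := hKc.isSeparable.exists_countable_dense_subset
  have hset : (fun s => φ (w s)) ⁻¹' Iic c =
      ⋂ j : ℕ, ⋃ d ∈ D, {s | g s d < 1 / ((j : ℝ) + 1)} := by
    ext s
    simp only [mem_preimage, mem_Iic, mem_iInter, mem_iUnion, mem_ofPred_eq, exists_prop]
    constructor
    · intro h j
      have hwK : w s ∈ K := ⟨hwU s, h⟩
      have hlt : ∀ᶠ v in 𝓝[K] (w s), g s v < 1 / ((j : ℝ) + 1) := by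
        have := ((hgc s).mono inter_subset_left) (w s) hwK
        refine this.eventually (gt_mem_nhds ?_)
        rw [hw0]; positivity
      have hfr : ∃ᶠ v in 𝓝 (w s), v ∈ D := mem_closure_iff_frequently.1 (hD hwK)
      obtain ⟨v, hv, hv'⟩ := (hfr.and_eventually (eventually_nhdsWithin_iff.1 hlt)).exists
      exact ⟨v, hv, hv' (hDK hv)⟩
    · intro h
      obtain ⟨d, hd, -⟩ := h 0
      obtain ⟨v, hvK, hv⟩ := hKc.exists_isMinOn ⟨d, hDK hd⟩ ((hgc s).mono inter_subset_left)
      have hle : g s v ≤ 0 := by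
        refine ge_of_tendsto' tendsto_one_div_add_atTop_nhds_zero_nat fun j => ?_
        obtain ⟨d, hd, hdj⟩ := h j
        exact (hv (hDK hd)).trans hdj.le
      exact (hwmin s v hvK.1 (le_antisymm hle (hg0 s v hvK.1))).trans hvK.2
  rw [hset]
  exact MeasurableSet.iInter fun j => MeasurableSet.biUnion hDc fun d hd =>
    measurableSet_lt (hgm d (hDK hd).1) measurable_const

/-- Measurable selection of a zero of a Carathéodory function on a compact set. -/
theorem exists_measurable_zero {α : Type*} [MeasurableSpace α] {m : ℕ}
    {U : Set (En m)} (hU : IsCompact U) {g : α → En m → ℝ}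
    (hgm : ∀ u ∈ U, Measurable fun s => g s u)
    (hgc : ∀ s, ContinuousOn (g s) U) (hg0 : ∀ s, ∀ u ∈ U, 0 ≤ g s u)
    (hex : ∀ s, ∃ u ∈ U, g s u = 0) :
    ∃ u : α → En m, Measurable u ∧ ∀ s, u s ∈ U ∧ g s (u s) = 0 := by
  have key : ∀ S : Finset (Fin m), ∃ w : Fin m → α → ℝ, (∀ i, Measurable (w i)) ∧
      ∀ s, ∃ u ∈ U, g s u = 0 ∧ ∀ i ∈ S, u i = w i s := by
    intro S
    induction S using Finset.induction_on with
    | empty =>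
      refine ⟨fun _ _ => 0, fun _ => measurable_const, fun s => ?_⟩
      simpa using hex s
    | insert i S hi ih =>
      obtain ⟨w, hwm, hw⟩ := ih
      have hsum : ∀ s (u : En m), 0 ≤ ∑ j ∈ S, |u j - w j s| := fun s u =>
        Finset.sum_nonneg fun _ _ => abs_nonneg _
      obtain ⟨v, hvm, hv⟩ := exists_measurable_value_on_zeros hU
        (g := fun s (u : En m) => g s u + ∑ j ∈ S, |u j - w j s|)
        (fun u hu => (hgm u hu).add (Finset.measurable_sum _ fun j _ =>
          (measurable_const.sub (hwm j)).abs))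
        (fun s => (hgc s).add (by fun_prop))
        (fun s u hu => add_nonneg (hg0 s u hu) (hsum s u))
        (fun s => by
          obtain ⟨u, hu, hu0, huS⟩ := hw s
          refine ⟨u, hu, ?_⟩
          rw [hu0, zero_add]
          exact Finset.sum_eq_zero fun j hj => by rw [huS j hj, sub_self, abs_zero])
        (φ := fun u : En m => u i) (by fun_prop)
      refine ⟨Function.update w i v, fun j => ?_, fun s => ?_⟩
      · by_cases hj : j = i
        · subst hj; simpa using hvm
        · simpa [hj] using hwm j
      · obtain ⟨u, hu, hu0, hui⟩ := hv s
        obtain ⟨hg, hs⟩ := (add_eq_zero_iff_of_nonneg (hg0 s u hu) (hsum s u)).1 hu0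
        refine ⟨u, hu, hg, fun j hj => ?_⟩
        by_cases hji : j = i
        · subst hji; simpa using hui
        · have hjS := (Finset.mem_insert.1 hj).resolve_left hji
          have := (Finset.sum_eq_zero_iff_of_nonneg fun _ _ => abs_nonneg _).1 hs j hjS
          simpa [hji] using sub_eq_zero.1 (abs_eq_zero.1 this)
  obtain ⟨w, hwm, hw⟩ := key Finset.univ
  refine ⟨fun s => WithLp.toLp 2 fun i => w i s,
    (WithLp.measurable_toLp 2 _).comp (measurable_pi_lambda _ hwm), fun s => ?_⟩
  obtain ⟨u, hu, hu0, hus⟩ := hw s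
  have : WithLp.toLp 2 (fun i => w i s) = u := by
    ext i
    exact (hus i (Finset.mem_univ i)).symm
  beta_reduce
  rw [this]
  exact ⟨hu, hu0⟩

/-! ### Lipschitz curves -/

/-- The fundamental theorem of calculus for Lipschitz curves in a finite-dimensional space. -/
theorem LipschitzWith.integral_deriv_eq_sub {E : Type*} [NormedAddCommGroup E] [NormedSpace ℝ E]
    [FiniteDimensional ℝ E] {C : NNReal} {Z : ℝ → E} (hZ : LipschitzWith C Z) (a b : ℝ) :
    IntervalIntegrable (deriv Z) volume a b ∧ ∫ s in a..b, deriv Z s = Z b - Z a := by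
  borelize E
  have : CompleteSpace E := FiniteDimensional.complete ℝ E
  have hint : IntervalIntegrable (deriv Z) volume a b :=
    (intervalIntegrable_const (c := (C : ℝ))).mono_fun
      (stronglyMeasurable_deriv Z).aestronglyMeasurable
      (Eventually.of_forall fun s => by
        simpa using norm_deriv_le_of_lipschitz (x₀ := s) hZ)
  refine ⟨hint, (SeparatingDual.eq_iff_forall_dual_eq (R := ℝ)).2 fun ℓ => ?_⟩
  have hℓ := (ℓ.lipschitz.comp hZ).lipschitzOnWith (s := uIcc a b)
  rw [← ℓ.intervalIntegral_comp_comm hint, map_sub]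
  refine Eq.trans ?_ hℓ.absolutelyContinuousOnInterval.integral_deriv_eq_sub
  refine intervalIntegral.integral_congr_ae ?_
  filter_upwards [hZ.ae_differentiableAt_real] with s hs _
  exact ((ℓ.hasFDerivAt.comp_hasDerivAt s hs.hasDerivAt).deriv).symm

/-- Pointwise limits of primitives: if the velocities `w k` eventually lie near a closed convex set
`Q` just after the time `s`, then the derivative of the limit curve at `s` lies in `Q`. -/
theorem mem_of_hasDerivAt_of_tendsto {E ι : Type*} [NormedAddCommGroup E] [NormedSpace ℝ E]
    [CompleteSpace E] {l : Filter ι} [l.NeBot] {Q : Set E} (hQ : Convex ℝ Q) (hQc : IsClosed Q)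
    {w Zs : ι → ℝ → E} {Z : ℝ → E} {s : ℝ} {z' : E}
    (hw : ∀ k a b, IntervalIntegrable (w k) volume a b)
    (hZs : ∀ k a b, Zs k b - Zs k a = ∫ r in a..b, w k r)
    (hlim : ∀ r, Tendsto (fun k => Zs k r) l (𝓝 (Z r)))
    (hnear : ∀ ε > 0, ∃ δ > 0, ∀ᶠ k in l, ∀ r ∈ Ioc s (s + δ), w k r ∈ Metric.cthickening ε Q)
    (hZ : HasDerivAt Z z' s) : z' ∈ Q := by
  rw [← hQc.closure_eq, Metric.closure_eq_iInter_cthickening]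
  refine mem_iInter₂.2 fun ε hε => ?_
  obtain ⟨δ, hδ, hk⟩ := hnear ε hε
  have hslope : Tendsto (slope Z s) (𝓝[>] s) (𝓝 z') :=
    (hasDerivAt_iff_tendsto_slope.1 hZ).mono_left (nhdsWithin_mono _ fun r hr => ne_of_gt hr)
  refine Metric.isClosed_cthickening.mem_of_tendsto hslope ?_
  filter_upwards [Ioc_mem_nhdsGT (show s < s + δ by linarith)] with b hb
  have hlimb : Tendsto (fun k => (b - s)⁻¹ • (Zs k b - Zs k s)) l (𝓝 (slope Z s b)) := by
    rw [slope_def_module]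
    exact ((hlim b).sub (hlim s)).const_smul _
  refine Metric.isClosed_cthickening.mem_of_tendsto hlimb ?_
  filter_upwards [hk] with k hk
  rw [hZs, ← interval_average_eq, uIoc_of_le hb.1.le]
  refine (hQ.cthickening ε).set_average_mem Metric.isClosed_cthickening ?_ ?_ ?_ ?_
  · simpa using hb.1
  · simp
  · exact ae_restrict_of_forall_mem measurableSet_Ioc fun r hr => hk r ⟨hr.1, hr.2.trans hb.2⟩
  · exact (hw k s b).1

/-- Pointwise limits along an ultrafilter of equi-Lipschitz curves which are bounded at one
point. -/
theorem exists_lipschitz_limit {E ι : Type*} [NormedAddCommGroup E] [ProperSpace E]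
    (l : Ultrafilter ι) {C : NNReal} {R : ℝ} {Zs : ι → ℝ → E} (hZs : ∀ k, LipschitzWith C (Zs k))
    (hR : ∀ k, ‖Zs k 0‖ ≤ R) :
    ∃ Z : ℝ → E, LipschitzWith C Z ∧ ∀ r, Tendsto (fun k => Zs k r) l (𝓝 (Z r)) := by
  have hex : ∀ r, ∃ z, Tendsto (fun k => Zs k r) l (𝓝 z) := by
    intro r
    obtain ⟨z, -, hz⟩ := (isCompact_closedBall (0 : E) (C * |r| + R)).ultrafilter_le_nhds
      (l.map fun k => Zs k r) (by
        simp only [Ultrafilter.coe_map, le_principal_iff, mem_map]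
        refine Eventually.of_forall fun k => ?_
        have h1 := (hZs k).dist_le_mul r 0
        rw [dist_eq_norm, Real.dist_eq, sub_zero] at h1
        simp only [mem_closedBall_zero_iff]
        calc ‖Zs k r‖ = ‖(Zs k r - Zs k 0) + Zs k 0‖ := by rw [sub_add_cancel]
          _ ≤ _ := (norm_add_le _ _).trans (add_le_add h1 (hR k)))
    exact ⟨z, hz⟩
  choose Z hZ using hex
  exact ⟨Z, LipschitzWith.of_dist_le_mul fun a b =>
    le_of_tendsto' ((hZ a).dist (hZ b)) fun k => (hZs k).dist_le_mul a b, hZ⟩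

/-- A backward Grönwall inequality in integral form. -/
theorem le_mul_exp_of_le_add_integral {y : ℝ → ℝ} (hy : Continuous y)
    {a K t : ℝ} (ha : 0 ≤ a) (hK : 0 ≤ K)
    (h : ∀ s ∈ Icc 0 t, y s ≤ a + K * ∫ r in s..t, y r) :
    ∀ s ∈ Icc 0 t, y s ≤ a * Real.exp (K * t) := by
  intro s hs
  have hd : ∀ s, HasDerivAt (fun s => (a + K * ∫ r in s..t, y r) * Real.exp (K * s))
      ((K * -y s) * Real.exp (K * s) + (a + K * ∫ r in s..t, y r) * (Real.exp (K * s) * K)) s := by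
    intro s
    have h1 := intervalIntegral.integral_hasDerivAt_left (hy.intervalIntegrable s t)
      (hy.stronglyMeasurableAtFilter _ _) hy.continuousAt
    have h2 : HasDerivAt (fun s : ℝ => Real.exp (K * s)) (Real.exp (K * s) * K) s := by
      simpa using ((hasDerivAt_id s).const_mul K).exp
    exact ((h1.const_mul K).const_add a).mul h2
  have hmono : MonotoneOn (fun s => (a + K * ∫ r in s..t, y r) * Real.exp (K * s)) (Icc 0 t) := by
    refine monotoneOn_of_deriv_nonneg (convex_Icc 0 t)
      (fun s _ => (hd s).continuousAt.continuousWithinAt)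
      (fun s _ => (hd s).differentiableAt.differentiableWithinAt) fun s hs => ?_
    rw [(hd s).deriv]
    have h3 := h s (interior_subset hs)
    have : 0 ≤ K * Real.exp (K * s) * (a + K * (∫ r in s..t, y r) - y s) :=
      mul_nonneg (by positivity) (by linarith)
    linarith
  have h4 := hmono hs ⟨hs.1.trans hs.2, le_rfl⟩ hs.2
  simp only [intervalIntegral.integral_same, mul_zero, add_zero] at h4
  have h5 : 1 ≤ Real.exp (K * s) := Real.one_le_exp (mul_nonneg hK hs.1)
  by_cases hys : 0 ≤ y s
  · calc y s ≤ y s * Real.exp (K * s) := le_mul_of_one_le_right hys h5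
      _ ≤ (a + K * ∫ r in s..t, y r) * Real.exp (K * s) := by gcongr; exact h s hs
      _ ≤ _ := h4
  · exact (not_le.1 hys).le.trans (by positivity)

/-- A priori bound for backward trajectories whose velocity grows at most linearly. -/
theorem norm_le_of_backward_integral {E : Type*} [NormedAddCommGroup E] [NormedSpace ℝ E]
    {γ v : ℝ → E} {x : E} {c κ t : ℝ} (hc : 0 ≤ c) (hκ : 0 ≤ κ) (ht : 0 ≤ t)
    (hγ : ContinuousOn γ (Icc 0 t)) (h : ∀ s ∈ Icc 0 t, γ s = x - ∫ r in s..t, v r)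
    (hv : ∀ r ∈ Icc 0 t, ‖v r‖ ≤ c + κ * ‖γ r‖) :
    ∀ s ∈ Icc 0 t, ‖γ s‖ ≤ (‖x‖ + c * t) * Real.exp (κ * t) := by
  set y : ℝ → ℝ := IccExtend ht fun s => ‖γ s‖ with hy
  have hyc : Continuous y := (continuousOn_iff_continuous_domRestrict.1 hγ.norm).Icc_extend'
  have hyγ : ∀ s ∈ Icc 0 t, y s = ‖γ s‖ := fun s hs => IccExtend_of_mem ht _ hs
  intro s hs
  rw [← hyγ s hs]
  refine le_mul_exp_of_le_add_integral hyc (by positivity) hκ (fun s hs => ?_) s hs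
  have hint : IntervalIntegrable (fun r => c + κ * y r) volume s t :=
    (by fun_prop : Continuous fun r => c + κ * y r).intervalIntegrable _ _
  have h1 : ‖∫ r in s..t, v r‖ ≤ ∫ r in s..t, (c + κ * y r) := by
    refine intervalIntegral.norm_integral_le_of_norm_le hs.2 (Eventually.of_forall fun r hr => ?_)
      hint
    have hr' : r ∈ Icc 0 t := ⟨hs.1.trans hr.1.le, hr.2⟩
    rw [hyγ r hr']
    exact hv r hr'
  rw [intervalIntegral.integral_add intervalIntegrable_const
    ((hyc.const_mul κ).intervalIntegrable _ _), intervalIntegral.integral_const,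
    intervalIntegral.integral_const_mul, smul_eq_mul] at h1
  rw [hyγ s hs, h s hs]
  have h2 : (t - s) * c ≤ c * t := by nlinarith [hs.1]
  linarith [norm_sub_le x (∫ r in s..t, v r)]

/-! ### Admissible pairs -/

/-- Coordinatewise truncation of a vector to `[-R, R]`. -/
def truncateCoords {n : ℕ} (R : ℝ) (y : En n) : En n :=
  WithLp.toLp 2 fun i => max (-R) (min R (y i))

theorem truncateCoords_lipschitz {n : ℕ} (R : ℝ) :
    LipschitzWith 1 (truncateCoords (n := n) R) := by
  refine LipschitzWith.of_dist_le_mul fun y z => ?_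
  rw [NNReal.coe_one, one_mul, EuclideanSpace.dist_eq, EuclideanSpace.dist_eq]
  refine Real.sqrt_le_sqrt (Finset.sum_le_sum fun i _ => ?_)
  refine pow_le_pow_left₀ dist_nonneg ?_ 2
  simp only [truncateCoords, Real.dist_eq]
  refine (abs_max_sub_max_le_max _ _ _ _).trans (max_le (by simp) ?_)
  exact (abs_min_sub_min_le_max _ _ _ _).trans (max_le (by simp) le_rfl)

theorem truncateCoords_eq_self {n : ℕ} {R : ℝ} {y : En n} (hy : ‖y‖ ≤ R) :
    truncateCoords R y = y := by
  ext i
  have h := abs_le.1 ((PiLp.norm_apply_le y i).trans hy)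
  simp [truncateCoords, min_eq_right h.2, max_eq_right h.1]

theorem norm_truncateCoords_le_norm {n : ℕ} {R : ℝ} (hR : 0 ≤ R) (y : En n) :
    ‖truncateCoords R y‖ ≤ ‖y‖ := by
  have h0 : truncateCoords R (0 : En n) = 0 := truncateCoords_eq_self (by simpa using hR)
  simpa [h0] using (truncateCoords_lipschitz R).dist_le_mul y 0

theorem norm_truncateCoords_le {n : ℕ} {R : ℝ} (hR : 0 ≤ R) (y : En n) :
    ‖truncateCoords R y‖ ≤ √(n * R ^ 2) := by
  rw [EuclideanSpace.norm_eq]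
  refine Real.sqrt_le_sqrt ?_
  calc ∑ i, ‖truncateCoords R y i‖ ^ 2 ≤ ∑ _i : Fin n, R ^ 2 := by
        refine Finset.sum_le_sum fun i _ => pow_le_pow_left₀ (norm_nonneg _) ?_ 2
        rw [Real.norm_eq_abs, abs_le]
        exact ⟨le_max_left _ _, max_le (by linarith) (min_le_left _ _)⟩
    _ = n * R ^ 2 := by simp

/-- Global backward solvability of an autonomous Lipschitz differential equation. -/
theorem exists_backward_solution {n : ℕ} {F : En n → En n} {K : NNReal} {c κ t : ℝ}
    (hF : LipschitzWith K F) (hc : 0 ≤ c) (hκ : 0 ≤ κ) (hb : ∀ y, ‖F y‖ ≤ c + κ * ‖y‖)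
    (ht : 0 ≤ t) (x : En n) :
    ∃ γ : ℝ → En n, ContinuousOn γ (Icc 0 t) ∧
      ∀ s ∈ Icc 0 t, γ s = x - ∫ r in s..t, F (γ r) := by
  set R := (‖x‖ + c * t) * Real.exp (κ * t) with hR
  have hR0 : 0 ≤ R := by positivity
  set G : En n → En n := fun y => F (truncateCoords R y) with hG
  have hGL : LipschitzWith (K * 1) G := hF.comp (truncateCoords_lipschitz R)
  set M : NNReal := ⟨c + κ * √(n * R ^ 2), by positivity⟩ with hM
  have hGM : ∀ y, ‖G y‖ ≤ M := fun y => (hb _).trans <| by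
    change _ ≤ c + κ * √(n * R ^ 2)
    gcongr
    exact norm_truncateCoords_le hR0 y
  have hPL : IsPicardLindelof (fun _ : ℝ => G) (tmin := 0) (tmax := t) ⟨t, ht, le_rfl⟩ x
      (M * ⟨t, ht⟩) 0 M (K * 1) :=
    .of_time_independent (fun y _ => hGM y) hGL.lipschitzOnWith (by
      simp only [sub_self, sub_zero, max_eq_right ht, NNReal.coe_zero]
      exact le_rfl)
  obtain ⟨γ, hγt, hγ⟩ := hPL.exists_eq_forall_mem_Icc_hasDerivWithinAt₀
  have hγc : ContinuousOn γ (Icc 0 t) := fun s hs => (hγ s hs).continuousWithinAt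
  have hγG : ContinuousOn (fun r => G (γ r)) (Icc 0 t) := hGL.continuous.comp_continuousOn hγc
  have hint : ∀ s ∈ Icc 0 t, γ s = x - ∫ r in s..t, G (γ r) := by
    intro s hs
    have hsub : Icc s t ⊆ Icc 0 t := Icc_subset_Icc_left hs.1
    rw [intervalIntegral.integral_eq_sub_of_hasDerivAt_of_le hs.2 (hγc.mono hsub)
      (fun r hr => (hγ r ⟨hs.1.trans hr.1.le, hr.2.le⟩).hasDerivAt
        (Icc_mem_nhds (hs.1.trans_lt hr.1) hr.2))
      ((hγG.mono hsub).intervalIntegrable_of_Icc hs.2)]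
    rw [show γ t = x from hγt, sub_sub_cancel]
  have hbound := norm_le_of_backward_integral hc hκ ht hγc hint fun r _ => (hb _).trans <| by
    gcongr
    exact norm_truncateCoords_le_norm hR0 _
  refine ⟨γ, hγc, fun s hs => ?_⟩
  rw [hint s hs]
  congr 1
  refine intervalIntegral.integral_congr fun r hr => ?_
  rw [uIcc_of_le hs.2] at hr
  exact congrArg F (truncateCoords_eq_self (hbound r ⟨hs.1.trans hr.1, hr.2⟩))

/-- Evaluating a continuous integrand along an admissible pair gives a measurable function. -/
theorem IsAdmissible.stronglyMeasurable_indicator {n m : ℕ} {f : En n → En m → En n}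
    {U : Set (En m)} {t : ℝ} {u : ℝ → En m} {γ : ℝ → En n} (h : IsAdmissible f U 0 t u γ)
    (ht : 0 ≤ t) {E : Type*} [NormedAddCommGroup E] [SecondCountableTopology E]
    {g : En n × En m × ℝ → E} (hg : Continuous g) :
    StronglyMeasurable ((Icc 0 t).indicator fun r => g (γ r, u r, r)) := by
  obtain ⟨hu, -, hγ, -⟩ := h
  have hγ' : Continuous (IccExtend ht fun s => γ s) :=
    (continuousOn_iff_continuous_domRestrict.1 hγ).Icc_extend'
  have heq : (Icc 0 t).indicator (fun r => g (γ r, u r, r)) =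
      (Icc 0 t).indicator fun r => g (IccExtend ht (fun s => γ s) r, u r, r) :=
    indicator_congr fun r hr => by rw [IccExtend_of_mem ht _ hr]
  rw [heq]
  exact (hg.comp_stronglyMeasurable
    (hγ'.measurable.prodMk (hu.prodMk measurable_id)).stronglyMeasurable).indicator
      measurableSet_Icc

/-- A continuous integrand is bounded along curves in a ball with controls in a compact set. -/
theorem exists_norm_le_of_compact_controls {n m : ℕ} {U : Set (En m)} (hU : IsCompact U)
    {E : Type*} [NormedAddCommGroup E] {g : En n × En m × ℝ → E} (hg : Continuous g) (R t : ℝ) :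
    ∃ M : NNReal, ∀ y, ∀ u ∈ U, ∀ r ∈ Icc 0 t, ‖y‖ ≤ R → ‖g (y, u, r)‖ ≤ M := by
  obtain ⟨M, hM⟩ := ((isCompact_closedBall (0 : En n) R).prod (hU.prod
    (isCompact_Icc (a := 0) (b := t)))).exists_bound_of_continuousOn hg.continuousOn
  refine ⟨M.toNNReal, fun y u hu r hr hy => (hM (y, u, r) ⟨?_, hu, hr⟩).trans
    (Real.le_coe_toNNReal M)⟩
  simpa using hy

theorem IsAdmissible.integrableOn {n m : ℕ} {f : En n → En m → En n}
    {U : Set (En m)} (hU : IsCompact U) {t : ℝ} {u : ℝ → En m} {γ : ℝ → En n}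
    (h : IsAdmissible f U 0 t u γ)
    (ht : 0 ≤ t) {E : Type*} [NormedAddCommGroup E] [SecondCountableTopology E]
    {g : En n × En m × ℝ → E} (hg : Continuous g) :
    IntegrableOn (fun r => g (γ r, u r, r)) (Icc 0 t) := by
  obtain ⟨R, hR⟩ := isCompact_Icc.exists_bound_of_continuousOn h.2.2.1
  obtain ⟨M, hM⟩ := exists_norm_le_of_compact_controls hU hg R t
  refine IntegrableOn.of_bound measure_Icc_lt_top
    ((aestronglyMeasurable_indicator_iff measurableSet_Icc).1
      (h.stronglyMeasurable_indicator ht hg).aestronglyMeasurable) M ?_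
  exact ae_restrict_of_forall_mem measurableSet_Icc fun r hr =>
    hM _ _ (h.2.1 r hr) r hr (hR r hr)

theorem IsAdmissible.intervalIntegrable {n m : ℕ} {f : En n → En m → En n}
    {U : Set (En m)} (hU : IsCompact U) {t : ℝ} {u : ℝ → En m} {γ : ℝ → En n}
    (h : IsAdmissible f U 0 t u γ)
    (ht : 0 ≤ t) {E : Type*} [NormedAddCommGroup E] [SecondCountableTopology E]
    {g : En n × En m × ℝ → E} (hg : Continuous g) {a b : ℝ} (ha : a ∈ Icc 0 t)
    (hb : b ∈ Icc 0 t) :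
    IntervalIntegrable (fun r => g (γ r, u r, r)) volume a b :=
  ((h.integrableOn hU ht hg).mono_set
    (ordConnected_Icc.uIcc_subset ha hb)).intervalIntegrable

/-- Admissible trajectories with prescribed endpoint are uniformly bounded. -/
theorem IsAdmissible.norm_le {n m : ℕ} {f : En n → En m → En n}
    (hf : Continuous fun p : En n × En m => f p.1 p.2)
    {U : Set (En m)} (hU : IsCompact U) {t : ℝ} {u : ℝ → En m} {γ : ℝ → En n}
    (h : IsAdmissible f U 0 t u γ) (ht : 0 ≤ t) {c κ : ℝ} (hc : 0 ≤ c) (hκ : 0 ≤ κ)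
    (hb : ∀ y, ∀ v ∈ U, ‖f y v‖ ≤ c + κ * ‖y‖) :
    ∀ s ∈ Icc 0 t, ‖γ s‖ ≤ (‖γ t‖ + c * t) * Real.exp (κ * t) := by
  refine norm_le_of_backward_integral (v := fun r => f (γ r) (u r)) hc hκ ht h.2.2.1
    (fun s hs => ?_) fun r hr => hb _ _ (h.2.1 r hr)
  have hg : Continuous fun p : En n × En m × ℝ => f p.1 p.2.1 :=
    hf.comp (continuous_fst.prodMk continuous_snd.fst)
  have h0 : (0 : ℝ) ∈ Icc 0 t := ⟨le_rfl, ht⟩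
  have hT : t ∈ Icc 0 t := ⟨ht, le_rfl⟩
  have := intervalIntegral.integral_add_adjacent_intervals
    (h.intervalIntegrable hU ht hg h0 hs) (h.intervalIntegrable hU ht hg hs hT)
  have h1 := h.2.2.2 s hs
  have h2 := h.2.2.2 t hT
  rw [h2, ← this, ← add_assoc, ← h1, add_sub_cancel_right]

/-- There is an admissible pair with constant control and prescribed endpoint. -/
theorem exists_isAdmissible_const {n m : ℕ} {f : En n → En m → En n} {U : Set (En m)}
    {u₀ : En m} (hu₀ : u₀ ∈ U) {K : NNReal} (hF : LipschitzWith K fun y => f y u₀) {c κ t : ℝ}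
    (hc : 0 ≤ c) (hκ : 0 ≤ κ) (hb : ∀ y, ‖f y u₀‖ ≤ c + κ * ‖y‖) (ht : 0 ≤ t) (x : En n) :
    ∃ γ, IsAdmissible f U 0 t (fun _ => u₀) γ ∧ γ t = x := by
  obtain ⟨γ, hγc, hγ⟩ := exists_backward_solution hF hc hκ hb ht x
  have hcont : ContinuousOn (fun r => f (γ r) u₀) (Icc 0 t) :=
    hF.continuous.comp_continuousOn hγc
  refine ⟨γ, ⟨measurable_const, fun _ _ => hu₀, hγc, fun s hs => ?_⟩, ?_⟩
  · have h0 := hγ 0 ⟨le_rfl, ht⟩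
    rw [hγ s hs, h0, ← intervalIntegral.integral_add_adjacent_intervals (b := s)
      ((hcont.mono (Icc_subset_Icc_right hs.2)).intervalIntegrable_of_Icc hs.1)
      ((hcont.mono (Icc_subset_Icc_left hs.1)).intervalIntegrable_of_Icc hs.2)]
    abel
  · simpa using hγ t ⟨ht, le_rfl⟩

open scoped Pointwise in
/-- The set of velocities and upper bounds for the cost is closed for compact control sets. -/
theorem isClosed_velocity_epigraph {X E : Type*} [TopologicalSpace X] [NormedAddCommGroup E]
    {U : Set X} (hU : IsCompact U) {φ : X → E} {ψ : X → ℝ} (hφ : Continuous φ)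
    (hψ : Continuous ψ) : IsClosed {p : E × ℝ | ∃ u ∈ U, p.1 = φ u ∧ ψ u ≤ p.2} := by
  have heq : {p : E × ℝ | ∃ u ∈ U, p.1 = φ u ∧ ψ u ≤ p.2} =
      ({0} : Set E) ×ˢ Ici (0 : ℝ) + (fun u => (φ u, ψ u)) '' U := by
    ext p
    constructor
    · rintro ⟨u, hu, hp1, hp2⟩
      exact ⟨(0, p.2 - ψ u), ⟨rfl, sub_nonneg.2 hp2⟩, _, ⟨u, hu, rfl⟩, by ext <;> simp [hp1]⟩
    · rintro ⟨⟨a, b⟩, ⟨ha, hb⟩, _, ⟨u, hu, rfl⟩, rfl⟩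
      refine ⟨u, hu, ?_, ?_⟩
      · simpa using ha
      · simpa using hb
  rw [heq]
  exact (isClosed_singleton.prod isClosed_Ici).add_right_of_isCompact
    (hU.image (hφ.prodMk hψ))

/-- Filippov's lemma: a measurable velocity–cost curve which almost everywhere lies in the
velocity–cost set along a continuous curve is realised by a measurable control. -/
theorem exists_measurable_control {n m : ℕ} {f : En n → En m → En n} {U : Set (En m)}
    {L : En n → En m → ℝ → ℝ} (hU : IsCompact U) (hUne : U.Nonempty)
    (hf : Continuous fun p : En n × En m => f p.1 p.2)
    (hL : Continuous fun p : En n × En m × ℝ => L p.1 p.2.1 p.2.2)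
    {γ : ℝ → En n} (hγ : Continuous γ) {v : ℝ → En n × ℝ} (hv : Measurable v) {J : Set ℝ}
    (hJ : MeasurableSet J)
    (hmem : ∀ᵐ s, s ∈ J → ∃ u ∈ U, (v s).1 = f (γ s) u ∧ L (γ s) u s ≤ (v s).2) :
    ∃ u : ℝ → En m, Measurable u ∧ (∀ s, u s ∈ U) ∧
      ∀ᵐ s, s ∈ J → (v s).1 = f (γ s) (u s) ∧ L (γ s) (u s) s ≤ (v s).2 := by
  classical
  obtain ⟨u₀, hu₀⟩ := hUne
  obtain ⟨N, hN, hNm, hN0⟩ := exists_measurable_superset_of_null (ae_iff.1 hmem)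
  set A := J \ N with hA
  have hAm : MeasurableSet A := hJ.diff hNm
  have hf' : Continuous fun p : ℝ × En m => f (γ p.1) p.2 :=
    hf.comp ((hγ.comp continuous_fst).prodMk continuous_snd)
  have hL' : Continuous fun p : ℝ × En m => L (γ p.1) p.2 p.1 :=
    hL.comp ((hγ.comp continuous_fst).prodMk (continuous_snd.prodMk continuous_fst))
  set v' : ℝ → En n × ℝ := A.piecewise v fun s => (f (γ s) u₀, L (γ s) u₀ s) with hv'
  have hv'm : Measurable v' := hv.piecewise hAm
    ((hf'.comp (.prodMk_left u₀)).prodMk (hL'.comp (.prodMk_left u₀))).measurable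
  have hex : ∀ s, ∃ u ∈ U, (v' s).1 = f (γ s) u ∧ L (γ s) u s ≤ (v' s).2 := by
    intro s
    by_cases hs : s ∈ A
    · rw [hv', piecewise_eq_of_mem _ _ _ hs]
      by_contra hcon
      exact hs.2 (hN fun h => hcon (h hs.1))
    · rw [hv', piecewise_eq_of_notMem _ _ _ hs]
      exact ⟨u₀, hu₀, rfl, le_rfl⟩
  obtain ⟨u, hum, hu⟩ := exists_measurable_zero hU
    (g := fun s u => ‖(v' s).1 - f (γ s) u‖ + max 0 (L (γ s) u s - (v' s).2))
    (fun u _ => (hv'm.fst.sub (hf'.comp (.prodMk_left u)).measurable).norm.add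
      (measurable_const.max ((hL'.comp (.prodMk_left u)).measurable.sub hv'm.snd)))
    (fun s => Continuous.continuousOn <|
      (continuous_const.sub (hf'.comp (.prodMk_right s))).norm.add
        (continuous_const.max ((hL'.comp (.prodMk_right s)).sub continuous_const)))
    (fun s u _ => by positivity)
    (fun s => by
      obtain ⟨u, hu, h1, h2⟩ := hex s
      exact ⟨u, hu, by rw [h1, sub_self, norm_zero, max_eq_left (by linarith), add_zero]⟩)
  refine ⟨u, hum, fun s => (hu s).1, ?_⟩
  filter_upwards [measure_eq_zero_iff_ae_notMem.1 hN0] with s hs hsJ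
  obtain ⟨h1, h2⟩ := (add_eq_zero_iff_of_nonneg (norm_nonneg _) (le_max_left _ _)).1 (hu s).2
  have hvs : v' s = v s := piecewise_eq_of_mem _ _ _ ⟨hsJ, hs⟩
  rw [hvs] at h1 h2
  exact ⟨sub_eq_zero.1 (norm_eq_zero.1 h1), sub_nonpos.1 (max_eq_left_iff.1 h2)⟩

/-- Closure theorem for velocity–cost curves: the derivative of a limit of curves
`(trajectory, accumulated cost)` lies in the velocity–cost set of the limit curve. -/
theorem deriv_limit_mem_velocity_epigraph {n m : ℕ} {ι : Type*} {l : Filter ι} [l.NeBot]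
    {f : En n → En m → En n} {U : Set (En m)} {L : En n → En m → ℝ → ℝ} (hU : IsCompact U)
    (hf : Continuous fun p : En n × En m => f p.1 p.2)
    (hL : Continuous fun p : En n × En m × ℝ => L p.1 p.2.1 p.2.2)
    {w Zs : ι → ℝ → En n × ℝ} {us : ι → ℝ → En m} {Z : ℝ → En n × ℝ} {C : NNReal} {s b : ℝ}
    (hsb : s < b)
    (hconv : Convex ℝ {p : En n × ℝ | ∃ u ∈ U, p.1 = f (Z s).1 u ∧ L (Z s).1 u s ≤ p.2})
    (hw : ∀ k a b, IntervalIntegrable (w k) volume a b)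
    (hZw : ∀ k a b, Zs k b - Zs k a = ∫ r in a..b, w k r)
    (hZC : ∀ k, LipschitzWith C (Zs k))
    (hlim : ∀ r, Tendsto (fun k => Zs k r) l (𝓝 (Z r)))
    (hus : ∀ k, ∀ r ∈ Ioc s b, us k r ∈ U)
    (hwZ : ∀ k, ∀ r ∈ Ioc s b,
      w k r = (f (Zs k r).1 (us k r), L (Zs k r).1 (us k r) r))
    (hd : DifferentiableAt ℝ Z s) :
    ∃ u ∈ U, (deriv Z s).1 = f (Z s).1 u ∧ L (Z s).1 u s ≤ (deriv Z s).2 := by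
  have hfs : Continuous fun u => f (Z s).1 u := hf.comp (.prodMk_right _)
  have hLs : Continuous fun u => L (Z s).1 u s :=
    hL.comp (continuous_const.prodMk (continuous_id.prodMk continuous_const))
  refine mem_of_hasDerivAt_of_tendsto hconv (isClosed_velocity_epigraph hU hfs hLs) hw hZw hlim
    (fun ε hε => ?_) hd.hasDerivAt
  have hg : Continuous fun p : (En n × ℝ) × En m =>
      dist (f p.1.1 p.2, L p.1.1 p.2 p.1.2) (f (Z s).1 p.2, L (Z s).1 p.2 s) := by
    refine Continuous.dist (Continuous.prodMk ?_ ?_) (Continuous.prodMk ?_ ?_)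
    · exact hf.comp (by fun_prop : Continuous fun p : (En n × ℝ) × En m => (p.1.1, p.2))
    · exact hL.comp (by fun_prop : Continuous fun p : (En n × ℝ) × En m => (p.1.1, p.2, p.1.2))
    · exact hfs.comp continuous_snd
    · exact hLs.comp continuous_snd
  have hev := hU.eventually_forall_of_forall_eventually (x₀ := ((Z s).1, s))
    (P := fun q u => dist (f q.1 u, L q.1 u q.2) (f (Z s).1 u, L (Z s).1 u s) < ε)
    fun u _ => hg.continuousAt.eventually (gt_mem_nhds (by simpa using hε))
  obtain ⟨η, hη, hball⟩ := Metric.eventually_nhds_iff.1 hev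
  have hC : (0 : ℝ) < C + 1 := by positivity
  refine ⟨min (b - s) (η / 2 / (C + 1)), lt_min (sub_pos.2 hsb) (by positivity), ?_⟩
  filter_upwards [Metric.tendsto_nhds.1 (hlim s) (η / 2) (by positivity)] with k hk r hr
  have hrb : r ∈ Ioc s b := ⟨hr.1, hr.2.trans (by linarith [min_le_left (b - s) (η / 2 / (C + 1))])⟩
  have hrs : (C + 1) * (r - s) ≤ η / 2 := by
    have : r - s ≤ η / 2 / (C + 1) := by
      linarith [hr.2, min_le_right (b - s) (η / 2 / (C + 1))]
    rwa [le_div_iff₀' hC] at this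
  have hrs0 : 0 < r - s := sub_pos.2 hr.1
  have hdr : dist r s = r - s := by rw [Real.dist_eq, abs_of_pos hrs0]
  have h1 := (hZC k).dist_le_mul r s
  rw [hdr] at h1
  have hdist : dist ((Zs k r).1, r) ((Z s).1, s) < η := by
    rw [Prod.dist_eq, max_lt_iff, hdr]
    constructor
    · calc dist (Zs k r).1 (Z s).1 ≤ dist (Zs k r) (Z s) := le_max_left _ _
        _ ≤ dist (Zs k r) (Zs k s) + dist (Zs k s) (Z s) := dist_triangle _ _ _
        _ < η := by linarith
    · nlinarith [C.coe_nonneg]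
  rw [hwZ k r hrb]
  exact Metric.mem_cthickening_of_dist_le _ _ _ _ ⟨us k r, hus k r hrb, rfl, le_rfl⟩
    (hball hdist _ (hus k r hrb)).le

/-- Existence of an optimal control for the Bolza problem. -/
theorem bolza_optimal_control_exists {n m : ℕ} (T : ℝ) (hT : 0 < T)
    (U : Set (En m)) (hU : IsCompact U) (hUne : U.Nonempty)
    (f : En n → En m → En n)
    (hf : Continuous fun p : En n × En m => f p.1 p.2)
    (K₀ : ℝ) (hK₀ : 0 < K₀)
    (hA1 : ∀ x u, ‖f x u‖ ≤ K₀ * (1 + ‖x‖ + ‖u‖))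
    (K₁ : ℝ) (hK₁ : 0 < K₁)
    (hA2 : ∀ x₁ x₂ u, u ∈ U → ‖f x₂ u - f x₁ u‖ ≤ K₁ * ‖x₂ - x₁‖)
    (L : En n → En m → ℝ → ℝ)
    (hL : Continuous fun p : En n × En m × ℝ => L p.1 p.2.1 p.2.2)
    (hL1 : ∀ K : ℝ, ∃ C : ℝ, ∀ x u t, u ∈ U → t ∈ Icc (0:ℝ) T →
      K * ‖u‖ - C ≤ L x u t)
    (hL2 : ∀ R > (0:ℝ), ∃ α : ℝ, ∀ x₁ x₂ u t, ‖x₁‖ ≤ R → ‖x₂‖ ≤ R → u ∈ U →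
      t ∈ Icc (0:ℝ) T → |L x₂ u t - L x₁ u t| ≤ α * ‖x₂ - x₁‖)
    (hLu : ∃ C : ℝ, ∀ x u₁ u₂ t, u₁ ∈ U → u₂ ∈ U → t ∈ Icc (0:ℝ) T →
      |L x u₁ t - L x u₂ t| ≤ C * ‖u₁ - u₂‖)
    (hL3 : ∀ x : En n, ∀ t ∈ Icc (0:ℝ) T,
      Convex ℝ { p : En n × ℝ | ∃ u ∈ U, p.1 = f x u ∧ L x u t ≤ p.2 })
    (I : En n → ℝ) (hI : Continuous I)
    (t : ℝ) (x : En n) (ht : t ∈ Ioc 0 T) :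
    ∃ u γ, IsAdmissible f U 0 t u γ ∧ γ t = x ∧
      valueFun f U L I t x =
        (∫ s in (0:ℝ)..t, L (γ s) (u s) s) + I (γ 0) := by
  have ht0 : (0 : ℝ) ≤ t := ht.1.le
  have h0m : (0 : ℝ) ∈ Icc 0 t := ⟨le_rfl, ht0⟩
  have htm : t ∈ Icc 0 t := ⟨ht0, le_rfl⟩
  obtain ⟨u₀, hu₀⟩ := id hUne
  obtain ⟨B, hB⟩ := hU.isBounded.exists_norm_le
  have hB0 : 0 ≤ B := (norm_nonneg u₀).trans (hB u₀ hu₀)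
  have hc : 0 ≤ K₀ * (1 + B) := by positivity
  have hgrow : ∀ y, ∀ v ∈ U, ‖f y v‖ ≤ K₀ * (1 + B) + K₀ * ‖y‖ := fun y v hv =>
    (hA1 y v).trans (by nlinarith [hB v hv])
  set R := (‖x‖ + K₀ * (1 + B) * t) * Real.exp (K₀ * t) with hR
  have hbound : ∀ {u γ}, IsAdmissible f U 0 t u γ → γ t = x → ∀ s ∈ Icc 0 t, ‖γ s‖ ≤ R := by
    intro u γ h hx
    simpa only [hx] using h.norm_le hf hU ht0 hc hK₀.le hgrow
  set g : En n × En m × ℝ → En n × ℝ := fun p => (f p.1 p.2.1, L p.1 p.2.1 p.2.2) with hg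
  have hf' : Continuous fun p : En n × En m × ℝ => f p.1 p.2.1 :=
    hf.comp (continuous_fst.prodMk continuous_snd.fst)
  have hgc : Continuous g := hf'.prodMk hL
  obtain ⟨C, hC⟩ := exists_norm_le_of_compact_controls hU hgc R t
  set S : Set ℝ := { J | ∃ u γ, IsAdmissible f U 0 t u γ ∧ γ t = x ∧
      J = (∫ s in (0:ℝ)..t, L (γ s) (u s) s) + I (γ 0) } with hS
  have hSne : S.Nonempty := by
    obtain ⟨γ, hγ, hγx⟩ := exists_isAdmissible_const (f := f) hu₀
      (LipschitzWith.of_dist_le_mul (K := ⟨K₁, hK₁.le⟩) fun y z => by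
        rw [dist_eq_norm, dist_eq_norm]
        exact hA2 z y u₀ hu₀) hc hK₀.le (fun y => hgrow y u₀ hu₀) ht0 x
    exact ⟨_, _, γ, hγ, hγx, rfl⟩
  have hSbdd : BddBelow S := by
    obtain ⟨c, hc⟩ := ((isCompact_closedBall (0 : En n) R).image hI).bddBelow
    refine ⟨-(C * |t - 0|) + c, ?_⟩
    rintro _ ⟨u, γ, h, hx, rfl⟩
    have h1 : ‖∫ s in (0:ℝ)..t, L (γ s) (u s) s‖ ≤ C * |t - 0| :=
      intervalIntegral.norm_integral_le_of_norm_le_const fun r hr => by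
        rw [uIoc_of_le ht0] at hr
        have hr' := Ioc_subset_Icc_self hr
        exact (norm_snd_le _).trans (hC _ _ (h.2.1 r hr') r hr' (hbound h hx r hr'))
    have h2 := hc ⟨γ 0, by simpa using hbound h hx 0 h0m, rfl⟩
    linarith [neg_abs_le (∫ s in (0:ℝ)..t, L (γ s) (u s) s),
      Real.norm_eq_abs (∫ s in (0:ℝ)..t, L (γ s) (u s) s)]
  obtain ⟨J, -, hJlim, hJS⟩ := exists_seq_tendsto_sInf hSne hSbdd
  choose us γs hadm hend hcost using hJS
  set w : ℕ → ℝ → En n × ℝ := fun k =>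
    (Icc 0 t).indicator fun r => g (γs k r, us k r, r) with hw
  have hwC : ∀ k r, ‖w k r‖ ≤ C := fun k r => by
    by_cases hr : r ∈ Icc 0 t
    · rw [hw]
      simp only [indicator_of_mem hr]
      exact hC _ _ ((hadm k).2.1 r hr) r hr (hbound (hadm k) (hend k) r hr)
    · simp [hw, indicator_of_notMem hr]
  have hwint : ∀ k a b, IntervalIntegrable (w k) volume a b := fun k a b =>
    (intervalIntegrable_const (c := (C : ℝ))).mono_fun
      ((hadm k).stronglyMeasurable_indicator ht0 hgc).aestronglyMeasurable
      (Eventually.of_forall fun r => by simpa using hwC k r)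
  set Zs : ℕ → ℝ → En n × ℝ := fun k s => (γs k 0, 0) + ∫ r in (0:ℝ)..s, w k r with hZs
  have hZw : ∀ k a b, Zs k b - Zs k a = ∫ r in a..b, w k r := fun k a b => by
    rw [hZs, add_sub_add_left_eq_sub,
      intervalIntegral.integral_interval_sub_left (hwint k _ _) (hwint k _ _)]
  have hZC : ∀ k, LipschitzWith C (Zs k) := fun k => LipschitzWith.of_dist_le_mul fun a b => by
    rw [dist_eq_norm, hZw, Real.dist_eq]
    exact intervalIntegral.norm_integral_le_of_norm_le_const fun r _ => hwC k r
  have hZg : ∀ k, ∀ s ∈ Icc 0 t, Zs k s = (γs k 0, 0) + ∫ r in (0:ℝ)..s, g (γs k r, us k r, r) := by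
    intro k s hs
    refine congrArg ((γs k 0, (0 : ℝ)) + ·) (intervalIntegral.integral_congr fun r hr => ?_)
    rw [uIcc_of_le hs.1] at hr
    exact indicator_of_mem (show r ∈ Icc 0 t from ⟨hr.1, hr.2.trans hs.2⟩) _
  have hgint : ∀ k, ∀ s ∈ Icc 0 t, IntervalIntegrable (fun r => g (γs k r, us k r, r)) volume 0 s :=
    fun k s hs => (hadm k).intervalIntegrable hU ht0 hgc h0m hs
  have hZ1 : ∀ k, ∀ s ∈ Icc 0 t, (Zs k s).1 = γs k s := by
    intro k s hs
    have := (ContinuousLinearMap.fst ℝ (En n) ℝ).intervalIntegral_comp_comm (hgint k s hs)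
    rw [hZg k s hs, (hadm k).2.2.2 s hs]
    exact congrArg (γs k 0 + ·) this.symm
  have hZ2 : ∀ k, (Zs k t).2 = ∫ r in (0:ℝ)..t, L (γs k r) (us k r) r := by
    intro k
    have := (ContinuousLinearMap.snd ℝ (En n) ℝ).intervalIntegral_comp_comm (hgint k t htm)
    rw [hZg k t htm]
    exact (zero_add _).trans this.symm
  have hZs0 : ∀ k, Zs k 0 = (γs k 0, 0) := fun k => by simp [hZs]
  set l : Ultrafilter ℕ := hyperfilter ℕ with hl
  have hlat : (l : Filter ℕ) ≤ atTop := Nat.hyperfilter_le_atTop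
  obtain ⟨Z, hZ, hlim⟩ := exists_lipschitz_limit l hZC (R := R) fun k => by
    rw [hZs0, Prod.norm_mk, norm_zero, max_eq_left (norm_nonneg _)]
    exact hbound (hadm k) (hend k) 0 h0m
  have hZt : (Z t).1 = x := by
    refine tendsto_nhds_unique ((continuous_fst.tendsto _).comp (hlim t)) ?_
    refine tendsto_const_nhds.congr fun k => ?_
    exact ((hZ1 k t htm).trans (hend k)).symm
  have hZ0 : (Z 0).2 = 0 := by
    refine tendsto_nhds_unique ((continuous_snd.tendsto _).comp (hlim 0)) ?_
    refine tendsto_const_nhds.congr fun k => ?_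
    simp [hZs0]
  have hval : sInf S = (Z t).2 + I (Z 0).1 := by
    refine tendsto_nhds_unique (hJlim.mono_left hlat) ?_
    refine (((continuous_snd.tendsto _).comp (hlim t)).add
      (((hI.comp continuous_fst).tendsto _).comp (hlim 0))).congr fun k => ?_
    simp only [Function.comp_apply]
    rw [hcost k, hZ2, hZs0]
  have hmem : ∀ᵐ s, s ∈ Ioo 0 t →
      ∃ u ∈ U, (deriv Z s).1 = f (Z s).1 u ∧ L (Z s).1 u s ≤ (deriv Z s).2 := by
    filter_upwards [hZ.ae_differentiableAt_real] with s hs hst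
    refine deriv_limit_mem_velocity_epigraph (us := us) hU hf hL hst.2
      (hL3 _ s ⟨hst.1.le, hst.2.le.trans ht.2⟩) hwint hZw hZC hlim
      (fun k r hr => (hadm k).2.1 r ⟨hst.1.le.trans hr.1.le, hr.2⟩) (fun k r hr => ?_) hs
    have hr' : r ∈ Icc 0 t := ⟨hst.1.le.trans hr.1.le, hr.2⟩
    simp only [hw, indicator_of_mem hr', hg, hZ1 k r hr']
  have hγc : Continuous fun s => (Z s).1 := hZ.continuous.fst
  obtain ⟨u, hum, huU, hu⟩ := exists_measurable_control hU hUne hf hL hγc (measurable_deriv Z)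
    measurableSet_Ioo hmem
  have hne : ∀ᵐ s : ℝ, s ≠ t := by simp [ae_iff]
  have hadm' : IsAdmissible f U 0 t u fun s => (Z s).1 := by
    refine ⟨hum, fun s _ => huU s, hγc.continuousOn, fun s hs => ?_⟩
    obtain ⟨hint, heq⟩ := hZ.integral_deriv_eq_sub 0 s
    have h1 := (ContinuousLinearMap.fst ℝ (En n) ℝ).intervalIntegral_comp_comm hint
    have h2 : ∫ r in (0:ℝ)..s, f (Z r).1 (u r) = ∫ r in (0:ℝ)..s, (deriv Z r).1 := by
      refine intervalIntegral.integral_congr_ae ?_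
      filter_upwards [hu, hne] with r hr hrt hrs
      rw [uIoc_of_le hs.1] at hrs
      exact (hr ⟨hrs.1, (hrs.2.trans hs.2).lt_of_ne hrt⟩).1.symm
    rw [heq] at h1
    rw [h2]
    exact (add_eq_of_eq_sub' h1).symm
  refine ⟨u, fun s => (Z s).1, hadm', hZt, le_antisymm ?_ ?_⟩
  · exact csInf_le hSbdd ⟨u, _, hadm', hZt, rfl⟩
  · change _ ≤ sInf S
    rw [hval]
    gcongr
    obtain ⟨hint, heq⟩ := hZ.integral_deriv_eq_sub 0 t
    have h1 := (ContinuousLinearMap.snd ℝ (En n) ℝ).intervalIntegral_comp_comm hint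
    rw [heq] at h1
    have h2 : ∫ r in (0:ℝ)..t, (deriv Z r).2 = (Z t).2 := by
      refine h1.trans ?_
      simp [hZ0]
    rw [← h2]
    refine intervalIntegral.integral_mono_ae_restrict ht0
      (hadm'.intervalIntegrable hU ht0 hL h0m htm)
      ⟨hint.1.snd, hint.2.snd⟩ ?_
    rw [EventuallyLE, ae_restrict_iff' measurableSet_Icc]
    filter_upwards [hu, hne, (by simp [ae_iff] : ∀ᵐ s : ℝ, s ≠ 0)] with r hr hrt hr0 hrI
    exact (hr ⟨hrI.1.lt_of_ne hr0.symm, hrI.2.lt_of_ne hrt⟩).2
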